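/- Let M be a deterministic single-tape Turing machine with binary tape alphabet {0,1} (blank symbol 0), finite state set Q of cardinality N ≥ 1 with a fixed enumeration q ↦ index(q) ∈ {1,…,N}, and total transition function δ : Q × {0,1} → Q × {0,1} × {left, right}. A configuration of M is a triple (q, l, r) with q ∈ Q and l, r : ℕ → {0,1} the left and right halves of the tape (the symbol under the head being r(0)), and step(q, l, r) denotes the successor configuration under δ. Encode each configuration by ι(q, l, r) = (index(q)/N, Σ_{i=0}^∞ 2·l(i)·4^{−i−1}, Σ_{i=0}^∞ 2·r(i)·4^{−i−1}) ∈ ℝ³. Then there exist k ∈ ℕ, pairwise disjoint sets B₁, …, B_k ⊆ ℝ³ each of which is a product of three intervals with rational endpoints, and affine maps A₁, …, A_k : ℝ³ → ℝ³ with rational coefficients, such that every encoded configuration ι(c) lies in exactly one of the sets B_j, and for every configuration c, if ι(c) ∈ B_j then A_j(ι(c)) = ι(step(c)). In other words, a piecewise affine map with rational coefficients and finitely many rational-box pieces simulates M step by step on the encodings. -/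

import Mathlib

/-- One step of a deterministic single-tape Turing machine with binary tape
alphabet (`Bool`, `false` = blank `0`), state type `Q` and total transition
function `δ : Q × {0,1} → Q × {0,1} × {left, right}` (direction `true` =
right, `false` = left).  A configuration is `(q, l, r)` where `l, r : ℕ → Bool`
are the left and right halves of the tape and `r 0` is the scanned symbol. -/
def tmStep {Q : Type*} (δ : Q × Bool → Q × Bool × Bool) :
    Q × (ℕ → Bool) × (ℕ → Bool) → Q × (ℕ → Bool) × (ℕ → Bool) :=
  fun c =>
    let q := c.1
    let l := c.2.1
    let r := c.2.2
    let q' := (δ (q, r 0)).1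
    let s := (δ (q, r 0)).2.1
    let dir := (δ (q, r 0)).2.2
    if dir then
      -- move right: the written symbol `s` becomes the top of the left tape
      (q', fun i => if i = 0 then s else l (i - 1), fun i => r (i + 1))
    else
      -- move left: the top of the left tape becomes scanned; `s` follows it
      (q', fun i => l (i + 1),
        fun i => if i = 0 then l 0 else if i = 1 then s else r (i - 1))

/-- Base-4 encoding `Σ_{i=0}^∞ 2·w(i)·4^{−i−1}` of a binary tape half. -/
noncomputable def tapeEnc (w : ℕ → Bool) : ℝ :=
  ∑' i : ℕ, 2 * (cond (w i) (1 : ℝ) 0) * (4 : ℝ) ^ (-(i : ℤ) - 1)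

/-- Encoding `ι(q, l, r) = (index(q)/N, tape-encoding of l, tape-encoding of r)`
of a Turing machine configuration into `ℝ³`, where `index(q) ∈ {1, …, N}`. -/
noncomputable def configEnc {Q : Type*} [Fintype Q]
    (idx : Q ≃ Fin (Fintype.card Q)) (c : Q × (ℕ → Bool) × (ℕ → Bool)) :
    Fin 3 → ℝ :=
  ![((idx c.1 : ℕ) + 1 : ℝ) / (Fintype.card Q), tapeEnc c.2.1, tapeEnc c.2.2]

/-- A subset of `ℝ` which is an interval with rational endpoints. -/
def IsRatInterval (s : Set ℝ) : Prop :=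
  ∃ a b : ℚ, s = Set.Icc (a : ℝ) (b : ℝ) ∨ s = Set.Ico (a : ℝ) (b : ℝ) ∨
    s = Set.Ioc (a : ℝ) (b : ℝ) ∨ s = Set.Ioo (a : ℝ) (b : ℝ)

noncomputable def bv (b : Bool) : ℚ := cond b 1 0

theorem term_eq (w : ℕ → Bool) (i : ℕ) :
    2 * (cond (w i) (1 : ℝ) 0) * (4 : ℝ) ^ (-(i : ℤ) - 1)
      = (cond (w i) (1 : ℝ) 0) * ((1 / 2) * (1 / 4 : ℝ) ^ i) := by
  have h : (4 : ℝ) ^ (-(i : ℤ) - 1) = (1 / 4) * (1 / 4 : ℝ) ^ i := by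
    rw [zpow_sub₀ (by norm_num), zpow_neg, zpow_natCast, zpow_one, one_div, inv_pow]
    ring
  rw [h]; ring

theorem tapeEnc_eq (w : ℕ → Bool) :
    tapeEnc w = ∑' i : ℕ, (cond (w i) (1 : ℝ) 0) * ((1 / 2) * (1 / 4 : ℝ) ^ i) := by
  unfold tapeEnc
  exact tsum_congr (term_eq w)

theorem geo_sum : Summable (fun i : ℕ => (1 / 2) * (1 / 4 : ℝ) ^ i) :=
  (summable_geometric_of_lt_one (by norm_num) (by norm_num)).mul_left _

theorem term_nonneg (w : ℕ → Bool) (i : ℕ) :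
    0 ≤ (cond (w i) (1 : ℝ) 0) * ((1 / 2) * (1 / 4 : ℝ) ^ i) := by
  cases w i <;> simp

theorem term_le (w : ℕ → Bool) (i : ℕ) :
    (cond (w i) (1 : ℝ) 0) * ((1 / 2) * (1 / 4 : ℝ) ^ i) ≤ (1 / 2) * (1 / 4 : ℝ) ^ i := by
  cases w i <;> simp

theorem term_summable (w : ℕ → Bool) :
    Summable (fun i : ℕ => (cond (w i) (1 : ℝ) 0) * ((1 / 2) * (1 / 4 : ℝ) ^ i)) :=
  Summable.of_nonneg_of_le (term_nonneg w) (term_le w) geo_sum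

theorem tapeEnc_nonneg (w : ℕ → Bool) : 0 ≤ tapeEnc w := by
  rw [tapeEnc_eq]; exact tsum_nonneg (term_nonneg w)

theorem tapeEnc_le (w : ℕ → Bool) : tapeEnc w ≤ 1 := by
  rw [tapeEnc_eq]
  refine ((term_summable w).tsum_le_tsum (term_le w) geo_sum).trans ?_
  rw [tsum_mul_left, tsum_geometric_of_lt_one (by norm_num) (by norm_num)]
  norm_num

theorem tapeEnc_succ (w : ℕ → Bool) :
    tapeEnc w = (bv (w 0) : ℝ) / 2 + tapeEnc (fun i => w (i + 1)) / 4 := by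
  rw [tapeEnc_eq, tapeEnc_eq, (term_summable w).tsum_eq_zero_add, ← tsum_div_const]
  congr 1
  · cases w 0 <;> simp [bv]
  · refine tsum_congr fun i => ?_
    rw [pow_succ]; ring

/-- the boxes for tape halves starting with the given symbol -/
def tapeBox (b : Bool) : Set ℝ :=
  Set.Icc ((bv b / 2 : ℚ) : ℝ) ((bv b / 2 + 1 / 4 : ℚ) : ℝ)

theorem mem_tapeBox (w : ℕ → Bool) : tapeEnc w ∈ tapeBox (w 0) := by
  have h := tapeEnc_succ w
  have h0 := tapeEnc_nonneg (fun i => w (i + 1))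
  have h1 := tapeEnc_le (fun i => w (i + 1))
  constructor <;> push_cast <;> linarith

theorem tapeBox_inj {b b' : Bool} {x : ℝ} (h : x ∈ tapeBox b) (h' : x ∈ tapeBox b') :
    b = b' := by
  obtain ⟨h1, h2⟩ := h
  obtain ⟨h3, h4⟩ := h'
  cases b <;> cases b' <;> simp [bv] at * <;> linarith

noncomputable def stQ {Q : Type} [Fintype Q] (idx : Q ≃ Fin (Fintype.card Q)) (q : Q) : ℚ :=
  ((idx q : ℕ) + 1 : ℚ) / (Fintype.card Q)

theorem stQ_inj {Q : Type} [Fintype Q] (hN : 1 ≤ Fintype.card Q)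
    (idx : Q ≃ Fin (Fintype.card Q)) {q q' : Q}
    (h : stQ idx q = stQ idx q') : q = q' := by
  have hc : (Fintype.card Q : ℚ) ≠ 0 := by
    have : Fintype.card Q ≠ 0 := by omega
    exact_mod_cast this
  unfold stQ at h
  rw [div_left_inj' hc] at h
  apply idx.injective
  apply Fin.ext
  have := add_right_cancel h
  exact_mod_cast this

noncomputable def boxI {Q : Type} [Fintype Q] (idx : Q ≃ Fin (Fintype.card Q))
    (p : Q × Bool × Bool) : Fin 3 → Set ℝ :=
  ![Set.Icc (stQ idx p.1 : ℝ) (stQ idx p.1 : ℝ), tapeBox p.2.1, tapeBox p.2.2]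

theorem mem_box {Q : Type} [Fintype Q] (idx : Q ≃ Fin (Fintype.card Q))
    (p : Q × Bool × Bool) (x : Fin 3 → ℝ) :
    x ∈ Set.univ.pi (boxI idx p) ↔
      x 0 = stQ idx p.1 ∧ x 1 ∈ tapeBox p.2.1 ∧ x 2 ∈ tapeBox p.2.2 := by
  simp [Set.mem_pi, Fin.forall_fin_succ, boxI]

theorem box_inj {Q : Type} [Fintype Q] (hN : 1 ≤ Fintype.card Q)
    (idx : Q ≃ Fin (Fintype.card Q)) {p p' : Q × Bool × Bool} {x : Fin 3 → ℝ}
    (h : x ∈ Set.univ.pi (boxI idx p)) (h' : x ∈ Set.univ.pi (boxI idx p')) : p = p' := by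
  rw [mem_box] at h h'
  obtain ⟨a, b, c⟩ := h
  obtain ⟨a', b', c'⟩ := h'
  refine Prod.ext (stQ_inj hN idx ?_) (Prod.ext (tapeBox_inj b b') (tapeBox_inj c c'))
  exact_mod_cast a.symm.trans a'

theorem enc_mem {Q : Type} [Fintype Q] (idx : Q ≃ Fin (Fintype.card Q))
    (c : Q × (ℕ → Bool) × (ℕ → Bool)) :
    configEnc idx c ∈ Set.univ.pi (boxI idx (c.1, c.2.1 0, c.2.2 0)) := by
  rw [mem_box]
  exact ⟨by simp [configEnc, stQ], mem_tapeBox _, mem_tapeBox _⟩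

/-- linear part -/
def linM (dir : Bool) : Fin 3 → Fin 3 → ℚ :=
  if dir then ![![0, 0, 0], ![0, 1 / 4, 0], ![0, 0, 4]]
  else ![![0, 0, 0], ![0, 4, 0], ![0, 0, 1 / 4]]

/-- translation part -/
noncomputable def trV (dir : Bool) (t : ℚ) (s a b : Bool) : Fin 3 → ℚ :=
  if dir then ![t, bv s / 2, - 2 * bv b]
  else ![t, - 2 * bv a, bv a / 2 + bv s / 8 - bv b / 8]

theorem step_enc {Q : Type} [Fintype Q] (idx : Q ≃ Fin (Fintype.card Q))
    (δ : Q × Bool → Q × Bool × Bool) (c : Q × (ℕ → Bool) × (ℕ → Bool)) :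
    (fun i => (∑ m : Fin 3, (linM (δ (c.1, c.2.2 0)).2.2 i m : ℝ) * configEnc idx c m) +
      (trV (δ (c.1, c.2.2 0)).2.2 (stQ idx (δ (c.1, c.2.2 0)).1) (δ (c.1, c.2.2 0)).2.1
        (c.2.1 0) (c.2.2 0) i : ℝ)) = configEnc idx (tmStep δ c) := by
  obtain ⟨q, l, r⟩ := c
  have hl := tapeEnc_succ l
  have hr := tapeEnc_succ r
  rcases hd : δ (q, r 0) with ⟨q', s, dir⟩
  cases dir
  · have e1 := tapeEnc_succ (fun i => if i = 0 then l 0 else if i = 1 then s else r (i - 1))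
    have e2 := tapeEnc_succ (fun i => if i = 0 then s else r i)
    simp at e1 e2
    funext i
    fin_cases i
    · simp [hd, tmStep, configEnc, linM, trV, stQ, Fin.sum_univ_three]
    · simp [hd, tmStep, configEnc, linM, trV, Fin.sum_univ_three]
      linarith
    · simp [hd, tmStep, configEnc, linM, trV, Fin.sum_univ_three]
      linarith
  · have e1 := tapeEnc_succ (fun i => if i = 0 then s else l (i - 1))
    simp at e1
    funext i
    fin_cases i
    · simp [hd, tmStep, configEnc, linM, trV, stQ, Fin.sum_univ_three]
    · simp [hd, tmStep, configEnc, linM, trV, Fin.sum_univ_three]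
      linarith
    · simp [hd, tmStep, configEnc, linM, trV, Fin.sum_univ_three]
      linarith

/-- A piecewise affine map with rational coefficients, with finitely many
pieces each of which is a product of three rational intervals, simulates any
deterministic Turing machine step by step on the encodings of its
configurations. -/
theorem piecewise_affine_simulates_turing_machine
    (Q : Type) [Fintype Q] (hN : 1 ≤ Fintype.card Q)
    (idx : Q ≃ Fin (Fintype.card Q))
    (δ : Q × Bool → Q × Bool × Bool) :
    ∃ (k : ℕ) (B : Fin k → Set (Fin 3 → ℝ))
      (A : Fin k → (Fin 3 → ℝ) → (Fin 3 → ℝ)),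
      (∀ j j' : Fin k, j ≠ j' → Disjoint (B j) (B j')) ∧
      (∀ j : Fin k, ∃ I : Fin 3 → Set ℝ,
        (∀ i : Fin 3, IsRatInterval (I i)) ∧ B j = Set.univ.pi I) ∧
      (∀ j : Fin k, ∃ (M : Fin 3 → Fin 3 → ℚ) (v : Fin 3 → ℚ),
        ∀ x : Fin 3 → ℝ,
          A j x = fun i => (∑ m : Fin 3, (M i m : ℝ) * x m) + (v i : ℝ)) ∧
      (∀ c : Q × (ℕ → Bool) × (ℕ → Bool), ∃! j : Fin k, configEnc idx c ∈ B j) ∧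
      (∀ (c : Q × (ℕ → Bool) × (ℕ → Bool)) (j : Fin k),
        configEnc idx c ∈ B j →
          A j (configEnc idx c) = configEnc idx (tmStep δ c)) := by
  classical
  let e := (Fintype.equivFin (Q × Bool × Bool)).symm
  refine ⟨Fintype.card (Q × Bool × Bool), fun j => Set.univ.pi (boxI idx (e j)),
    fun j x i => (∑ m : Fin 3, (linM (δ ((e j).1, (e j).2.2)).2.2 i m : ℝ) * x m) +
      (trV (δ ((e j).1, (e j).2.2)).2.2 (stQ idx (δ ((e j).1, (e j).2.2)).1)
        (δ ((e j).1, (e j).2.2)).2.1 (e j).2.1 (e j).2.2 i : ℝ), ?_, ?_, ?_, ?_, ?_⟩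
  · intro j j' hj
    rw [Set.disjoint_left]
    intro x hx hx'
    exact hj (e.injective (box_inj hN idx hx hx'))
  · intro j
    refine ⟨_, ?_, rfl⟩
    intro i
    fin_cases i
    · exact ⟨_, _, Or.inl rfl⟩
    · exact ⟨_, _, Or.inl rfl⟩
    · exact ⟨_, _, Or.inl rfl⟩
  · intro j
    exact ⟨_, _, fun x => rfl⟩
  · intro c
    refine ⟨e.symm (c.1, c.2.1 0, c.2.2 0), ?_, ?_⟩
    · simpa using enc_mem idx c
    · intro j hj
      rw [Equiv.eq_symm_apply]
      exact box_inj hN idx hj (enc_mem idx c)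
  · intro c j hj
    have h := box_inj hN idx hj (enc_mem idx c)
    simp only [h]
    exact step_enc idx δ c
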